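/- With an orthonormal basis {φ_k} of a separable complex Hilbert space H, real numbers λ_k with |λ_1| ≤ |λ_2| ≤ ⋯ and |λ_k| → ∞, the diagonal operator L, the projections P_n, and the operator L† f = Σ_{k : λ_k ≠ 0} λ_k^{-1} ⟨φ_k, f⟩ φ_k: for every f ∈ H one has L† f ∈ D(L), and if some λ_k is nonzero then ‖L ∘ L†‖_{H→H} = 1; moreover, for every n ≥ 1 with λ_{n+1} ≠ 0, ‖L† − L† ∘ P_n‖_{H→H} = |λ_{n+1}|^{-1}. In particular, the operator A = L† achieves equality in the bound ‖A − A ∘ P_n‖ ≤ |λ_{n+1}|^{-1} ‖L A*‖ for all such n. -/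

import Mathlib

open scoped InnerProductSpace ComplexConjugate

noncomputable section

variable {H : Type*} [NormedAddCommGroup H] [InnerProductSpace ℂ H] [CompleteSpace H]

/-- The domain `D(L)` of the diagonal operator determined by the orthonormal basis `b`
and the real eigenvalues `lam`: those `f` with `Σ_k λ_k² |⟨φ_k, f⟩|² < ∞`. -/
def Ldom (b : HilbertBasis ℕ ℂ H) (lam : ℕ → ℝ) : Set H :=
  {f | Summable fun k => (lam k) ^ 2 * ‖⟪(b k : H), f⟫_ℂ‖ ^ 2}

/-- The diagonal operator `L f = Σ_k λ_k ⟨φ_k, f⟩ φ_k`. -/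
def Lop (b : HilbertBasis ℕ ℂ H) (lam : ℕ → ℝ) (f : H) : H :=
  ∑' k, ((lam k : ℂ) * ⟪(b k : H), f⟫_ℂ) • (b k : H)

/-- The orthogonal projection `P_n` onto the span of the first `n` basis vectors,
as a continuous linear map. -/
def PprojL (b : HilbertBasis ℕ ℂ H) (n : ℕ) : H →L[ℂ] H :=
  ∑ k ∈ Finset.range n, (innerSL ℂ (b k : H)).smulRight (b k : H)

/-- A number times its inverse (with `0⁻¹ = 0`) has norm at most one. -/
theorem norm_mul_inv_self_le_one (z : ℂ) : ‖z * z⁻¹‖ ≤ 1 := by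
  rcases eq_or_ne z 0 with rfl | h <;> simp [*]

/-- Parseval's identity for the coefficients in a Hilbert basis. -/
theorem HilbertBasis.hasSum_norm_inner_sq (b : HilbertBasis ℕ ℂ H) (f : H) :
    HasSum (fun k => ‖⟪(b k : H), f⟫_ℂ‖ ^ 2) (‖f‖ ^ 2) := by
  have h := lp.hasSum_norm (p := 2) (by norm_num) (b.repr f)
  simpa [b.repr_apply_apply] using h

/-- A bounded multiplier applied to the coefficients of `f` gives a convergent expansion
with the expected coefficients. -/
theorem HilbertBasis.inner_tsum_mul_smul (b : HilbertBasis ℕ ℂ H) {m : ℕ → ℂ} {C : ℝ}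
    (hm : ∀ k, ‖m k‖ ≤ C) (f : H) (j : ℕ) :
    ⟪(b j : H), ∑' k, (m k * ⟪(b k : H), f⟫_ℂ) • (b k : H)⟫_ℂ = m j * ⟪(b j : H), f⟫_ℂ := by
  have hc : Memℓp (fun k => m k * ⟪(b k : H), f⟫_ℂ) 2 := by
    refine memℓp_gen ?_
    refine Summable.of_nonneg_of_le (fun k => by positivity) (fun k => ?_)
      ((b.hasSum_norm_inner_sq f).summable.mul_left (C ^ 2))
    simp only [ENNReal.toReal_ofNat, Real.rpow_ofNat, norm_mul, mul_pow]
    gcongr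
    exact hm k
  let c : lp (fun _ : ℕ => ℂ) 2 := ⟨_, hc⟩
  have hsum : ∑' k, (m k * ⟪(b k : H), f⟫_ℂ) • (b k : H) = b.repr.symm c :=
    (b.hasSum_repr_symm c).tsum_eq
  rw [hsum, ← b.repr_apply_apply, LinearIsometryEquiv.apply_symm_apply]

/-- An operator which is diagonal in a Hilbert basis multiplies the basis vectors. -/
theorem HilbertBasis.apply_of_diagonal (b : HilbertBasis ℕ ℂ H) {m : ℕ → ℂ} {A : H →L[ℂ] H}
    (hA : ∀ f k, ⟪(b k : H), A f⟫_ℂ = m k * ⟪(b k : H), f⟫_ℂ) (j : ℕ) :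
    A (b j) = m j • (b j : H) := by
  apply b.repr.injective
  ext k
  rw [b.repr_apply_apply, b.repr_apply_apply, hA, inner_smul_right]
  rcases eq_or_ne k j with rfl | h
  · rfl
  · simp [b.orthonormal.inner_eq_zero h]

/-- The norm of a diagonal operator whose multiplier attains its maximal modulus at `j`. -/
theorem HilbertBasis.norm_of_diagonal (b : HilbertBasis ℕ ℂ H) {m : ℕ → ℂ} {A : H →L[ℂ] H}
    (hA : ∀ f k, ⟪(b k : H), A f⟫_ℂ = m k * ⟪(b k : H), f⟫_ℂ) {j : ℕ}
    (hj : ∀ k, ‖m k‖ ≤ ‖m j‖) : ‖A‖ = ‖m j‖ := by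
  apply le_antisymm
  · refine A.opNorm_le_bound (norm_nonneg _) fun f => ?_
    refine le_of_sq_le_sq ?_ (by positivity)
    rw [mul_pow]
    refine hasSum_le (fun k => ?_) (b.hasSum_norm_inner_sq (A f))
      ((b.hasSum_norm_inner_sq f).mul_left (‖m j‖ ^ 2))
    rw [hA, norm_mul, mul_pow]
    gcongr
    exact hj k
  · have h := A.le_opNorm (b j)
    rwa [b.apply_of_diagonal hA, norm_smul, b.orthonormal.norm_eq_one, mul_one, mul_one] at h

/-- The adjoint of a diagonal operator has the conjugate multiplier. -/
theorem HilbertBasis.inner_adjoint_of_diagonal (b : HilbertBasis ℕ ℂ H) {m : ℕ → ℂ}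
    {A : H →L[ℂ] H} (hA : ∀ f k, ⟪(b k : H), A f⟫_ℂ = m k * ⟪(b k : H), f⟫_ℂ) (f : H) (k : ℕ) :
    ⟪(b k : H), ContinuousLinearMap.adjoint A f⟫_ℂ = conj (m k) * ⟪(b k : H), f⟫_ℂ := by
  rw [ContinuousLinearMap.adjoint_inner_right, b.apply_of_diagonal hA, inner_smul_left]

/-- The projection `P_n` keeps exactly the first `n` coefficients. -/
theorem inner_PprojL (b : HilbertBasis ℕ ℂ H) (n : ℕ) (f : H) (k : ℕ) :
    ⟪(b k : H), PprojL b n f⟫_ℂ = if k < n then ⟪(b k : H), f⟫_ℂ else 0 := by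
  simp [PprojL, orthonormal_iff_ite.mp b.orthonormal]

/-- If `L` is applied after an operator with multiplier `λ⁻¹`, the coefficients along the
nonzero eigenvalues are restored and all others are removed. -/
theorem inner_Lop_of_inner_eq_inv_mul (b : HilbertBasis ℕ ℂ H) {lam : ℕ → ℝ} {f g : H}
    (hg : ∀ k, ⟪(b k : H), g⟫_ℂ = (lam k : ℂ)⁻¹ * ⟪(b k : H), f⟫_ℂ) (k : ℕ) :
    ⟪(b k : H), Lop b lam g⟫_ℂ = (lam k * (lam k : ℂ)⁻¹) * ⟪(b k : H), f⟫_ℂ := by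
  simp only [Lop, hg, ← mul_assoc]
  exact b.inner_tsum_mul_smul (m := fun k => lam k * (lam k : ℂ)⁻¹)
    (fun k => norm_mul_inv_self_le_one _) f k

/-- Let `T = L†` be the bounded operator with
`T f = Σ_{k : λ_k ≠ 0} λ_k⁻¹ ⟨φ_k, f⟩ φ_k`. Then `T f ∈ D(L)` for every `f`; if some
`λ_k ≠ 0` then `‖L ∘ L†‖ = 1`; and for every `n ≥ 1` with `λ n ≠ 0` (`0`-indexed, so
`λ n` is the paper's `λ_{n+1}`) one has `‖L† − L† P_n‖ = |λ n|⁻¹`. In particular `A = L†`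
achieves equality in the bound `‖A − A P_n‖ ≤ |λ n|⁻¹ ‖L A*‖`. -/
theorem stmt12 (b : HilbertBasis ℕ ℂ H) (lam : ℕ → ℝ)
    (hmono : Monotone fun k => |lam k|)
    (htend : Filter.Tendsto (fun k => |lam k|) Filter.atTop Filter.atTop)
    (T : H →L[ℂ] H)
    (hT : ∀ f : H, T f = ∑' k, if lam k = 0 then (0 : H)
      else ((lam k : ℂ)⁻¹ * ⟪(b k : H), f⟫_ℂ) • (b k : H)) :
    (∀ f : H, T f ∈ Ldom b lam) ∧
    ((∃ k, lam k ≠ 0) → ∀ S : H →L[ℂ] H, (∀ f : H, S f = Lop b lam (T f)) → ‖S‖ = 1) ∧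
    (∀ n : ℕ, 1 ≤ n → lam n ≠ 0 → ‖T - T.comp (PprojL b n)‖ = |lam n|⁻¹) ∧
    (∀ n : ℕ, 1 ≤ n → lam n ≠ 0 → ∀ S : H →L[ℂ] H,
      (∀ f : H, S f = Lop b lam (ContinuousLinearMap.adjoint T f)) →
      ‖T - T.comp (PprojL b n)‖ = |lam n|⁻¹ * ‖S‖) := by
  obtain ⟨C, hC⟩ : ∃ C, ∀ k, ‖(lam k : ℂ)⁻¹‖ ≤ C := by
    obtain ⟨C, hC⟩ := htend.inv_tendsto_atTop.bddAbove_range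
    exact ⟨C, fun k => by simpa using hC ⟨k, rfl⟩⟩
  have hdiag : ∀ f k, ⟪(b k : H), T f⟫_ℂ = (lam k : ℂ)⁻¹ * ⟪(b k : H), f⟫_ℂ := fun f k => by
    rw [hT, ← b.inner_tsum_mul_smul hC]
    congr 2 with k
    split_ifs with h <;> simp [h]
  have hadj : ∀ f k, ⟪(b k : H), ContinuousLinearMap.adjoint T f⟫_ℂ =
      (lam k : ℂ)⁻¹ * ⟪(b k : H), f⟫_ℂ := fun f k => by
    simpa using b.inner_adjoint_of_diagonal hdiag f k
  have hnorm_one : ∀ S : H →L[ℂ] H,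
      (∀ f k, ⟪(b k : H), S f⟫_ℂ = (lam k * (lam k : ℂ)⁻¹) * ⟪(b k : H), f⟫_ℂ) →
      ∀ j, lam j ≠ 0 → ‖S‖ = 1 := fun S hS j hj => by
    have hone : ‖(lam j : ℂ) * (lam j : ℂ)⁻¹‖ = 1 := by
      rw [mul_inv_cancel₀ (by exact_mod_cast hj), norm_one]
    rw [b.norm_of_diagonal hS (j := j) fun k => hone ▸ norm_mul_inv_self_le_one _, hone]
  have htail : ∀ n, lam n ≠ 0 → ‖T - T.comp (PprojL b n)‖ = |lam n|⁻¹ := fun n hn => by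
    have hA : ∀ f k, ⟪(b k : H), (T - T.comp (PprojL b n)) f⟫_ℂ =
        (if k < n then 0 else (lam k : ℂ)⁻¹) * ⟪(b k : H), f⟫_ℂ := fun f k => by
      simp only [sub_apply, ContinuousLinearMap.comp_apply, inner_sub_right,
        hdiag, inner_PprojL]
      split_ifs <;> simp
    rw [b.norm_of_diagonal hA (j := n) fun k => ?_]
    · simp
    · rcases lt_or_ge k n with h | h
      · simp [h]
      · simpa [h.not_gt] using inv_anti₀ (abs_pos.mpr hn) (hmono h)
  refine ⟨fun f => ?_, ?_, fun n _ hn => htail n hn, fun n _ hn S hS => ?_⟩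
  · refine Summable.of_nonneg_of_le (fun k => by positivity) (fun k => ?_)
      (b.hasSum_norm_inner_sq f).summable
    have h := norm_mul_inv_self_le_one (lam k : ℂ)
    calc lam k ^ 2 * ‖⟪(b k : H), T f⟫_ℂ‖ ^ 2
        = ‖(lam k : ℂ) * (lam k : ℂ)⁻¹‖ ^ 2 * ‖⟪(b k : H), f⟫_ℂ‖ ^ 2 := by
          rw [hdiag, norm_mul, norm_mul, Complex.norm_real, Real.norm_eq_abs, mul_pow, mul_pow,
            sq_abs, mul_assoc]
      _ ≤ 1 ^ 2 * ‖⟪(b k : H), f⟫_ℂ‖ ^ 2 := by gcongr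
      _ = ‖⟪(b k : H), f⟫_ℂ‖ ^ 2 := by ring
  · rintro ⟨j, hj⟩ S hS
    exact hnorm_one S (fun f k => hS f ▸ inner_Lop_of_inner_eq_inv_mul b (hdiag f) k) j hj
  · rw [htail n hn,
      hnorm_one S (fun f k => hS f ▸ inner_Lop_of_inner_eq_inv_mul b (hadj f) k) n hn, mul_one]

end
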